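/- arXiv:2009.06331 — 3 statements merged into one kernel-verified Lean document; each statement's English description precedes it below -/
import Mathlib

section
/- If n ≥ 4, S ⊆ {1,...,n-1}, |S| ≥ 2, and 1 ∈ S, then the proper connection number of the circulant digraph C_n(S) is at most 2. -/
/-!
Common definitions: digraphs as adjacency relations, directed walks and paths,
arc-colourings, proper connection and proper-walk connection numbers,
strong digraphs, bipartite digraphs, Hamiltonian cycles, chords,
circulant digraphs and strong 2-partitions.
-/

namespace PCDigraph

variable {V : Type*}

/-- A directed walk from `u` to `v` in the digraph with adjacency relation `Adj`. -/
inductive DWalk (Adj : V → V → Prop) : V → V → Type _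
  | nil {v : V} : DWalk Adj v v
  | cons {u v w : V} (h : Adj u v) (p : DWalk Adj v w) : DWalk Adj u w

namespace DWalk

variable {Adj : V → V → Prop}

/-- The list of arcs of a directed walk. -/
def arcs : ∀ {u v : V}, DWalk Adj u v → List (V × V)
  | _, _, .nil => []
  | u, _, .cons (v := w) _ p => (u, w) :: p.arcs

/-- The list of vertices visited by a directed walk. -/
def support : ∀ {u v : V}, DWalk Adj u v → List V
  | u, _, .nil => [u]
  | u, _, .cons _ p => u :: p.support

/-- A directed walk is a (directed) path if it visits no vertex twice. -/
def IsPath {u v : V} (p : DWalk Adj u v) : Prop := p.support.Nodup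

end DWalk

/-- A directed walk is properly coloured under the arc-colouring `c` if no two
consecutive arcs of the walk receive the same colour. -/
def ProperlyColoured {Adj : V → V → Prop} (c : V → V → ℕ) {u v : V}
    (p : DWalk Adj u v) : Prop :=
  (p.arcs.map fun e => c e.1 e.2).Chain' (· ≠ ·)

/-- `c` is an arc-colouring using colours in `{1, …, k}` that makes the digraph
properly connected: between every ordered pair of distinct vertices there is a
properly coloured directed path. -/
def IsPCColouring (Adj : V → V → Prop) (k : ℕ) (c : V → V → ℕ) : Prop :=
  (∀ u v : V, Adj u v → c u v ∈ Finset.Icc 1 k) ∧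
    ∀ u v : V, u ≠ v → ∃ p : DWalk Adj u v, p.IsPath ∧ ProperlyColoured c p

/-- `c` is an arc-colouring using colours in `{1, …, k}` that makes the digraph
properly-walk connected: between every ordered pair of distinct vertices there
is a properly coloured directed walk. -/
def IsWCColouring (Adj : V → V → Prop) (k : ℕ) (c : V → V → ℕ) : Prop :=
  (∀ u v : V, Adj u v → c u v ∈ Finset.Icc 1 k) ∧
    ∀ u v : V, u ≠ v → ∃ p : DWalk Adj u v, ProperlyColoured c p

/-- The proper connection number of a digraph. -/
noncomputable def pc (Adj : V → V → Prop) : ℕ :=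
  sInf {k : ℕ | ∃ c : V → V → ℕ, IsPCColouring Adj k c}

/-- The proper-walk connection number of a digraph. -/
noncomputable def wc (Adj : V → V → Prop) : ℕ :=
  sInf {k : ℕ | ∃ c : V → V → ℕ, IsWCColouring Adj k c}

/-- A digraph is strong if for every ordered pair of vertices there is a
directed path from the first to the second. -/
def Strong (Adj : V → V → Prop) : Prop :=
  ∀ u v : V, ∃ p : DWalk Adj u v, p.IsPath

/-- A digraph is bipartite if its vertex set can be partitioned into two sets
such that every arc joins vertices from different sets. -/
def Bipartite (Adj : V → V → Prop) : Prop :=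
  ∃ V₁ V₂ : Set V, V₁ ∪ V₂ = Set.univ ∧ Disjoint V₁ V₂ ∧
    ∀ u v : V, Adj u v → (u ∈ V₁ ∧ v ∈ V₂) ∨ (u ∈ V₂ ∧ v ∈ V₁)

/-- The out-degree of a vertex: the number of arcs with tail at that vertex. -/
noncomputable def outDeg (Adj : V → V → Prop) (v : V) : ℕ := {w | Adj v w}.ncard

/-- The in-degree of a vertex: the number of arcs with head at that vertex. -/
noncomputable def inDeg (Adj : V → V → Prop) (v : V) : ℕ := {w | Adj w v}.ncard

/-- `x` enumerates a Hamiltonian cycle of the digraph: it is a bijective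
enumeration of the vertices, consecutive vertices (cyclically) being joined
by an arc. -/
def IsHamCycle [Fintype V] (Adj : V → V → Prop)
    (x : ZMod (Fintype.card V) → V) : Prop :=
  Function.Bijective x ∧ ∀ i : ZMod (Fintype.card V), Adj (x i) (x (i + 1))

/-- A digraph is Hamiltonian if it has a Hamiltonian cycle. -/
def Hamiltonian [Fintype V] (Adj : V → V → Prop) : Prop :=
  ∃ x : ZMod (Fintype.card V) → V, IsHamCycle Adj x

/-- For a Hamiltonian cycle enumerated by `x`, the arc `x p → x q` is a chord
if it is not an arc of the cycle, i.e. `q ≠ p + 1`. -/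
def IsChord [Fintype V] (Adj : V → V → Prop)
    (x : ZMod (Fintype.card V) → V) (p q : ZMod (Fintype.card V)) : Prop :=
  Adj (x p) (x q) ∧ q ≠ p + 1

/-- The length of the chord from `x p` to `x q`: the length of the directed
path from `x p` to `x q` along the cycle. -/
def chordLength [Fintype V] (p q : ZMod (Fintype.card V)) : ℕ := (q - p).val

/-- The circulant digraph `C_n(S)`, with vertex set `ZMod n` and an arc from
`i` to `j` whenever `j - i ≡ s (mod n)` for some `s ∈ S`. -/
def circulantAdj (n : ℕ) (S : Finset ℕ) : ZMod n → ZMod n → Prop :=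
  fun i j => ∃ s ∈ S, j - i = (s : ZMod n)

/-- A strong 2-partition of a digraph: a partition of the vertex set into two
parts such that the spanning bipartite subdigraph induced by the arcs having
one end in each part is strong. -/
def HasStrongTwoPartition (Adj : V → V → Prop) : Prop :=
  ∃ V₁ V₂ : Set V, V₁ ∪ V₂ = Set.univ ∧ Disjoint V₁ V₂ ∧
    Strong (fun u v => Adj u v ∧ ((u ∈ V₁ ∧ v ∈ V₂) ∨ (u ∈ V₂ ∧ v ∈ V₁)))

end PCDigraph

open PCDigraph

namespace PCDigraph

open Relation

section Crossing

variable {V : Type*} {Adj : V → V → Prop}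

theorem DWalk.exists_suffix {u v x : V} (p : DWalk Adj u v) (hx : x ∈ p.support) :
    ∃ q : DWalk Adj x v, q.support <:+ p.support ∧ q.arcs <:+ p.arcs := by
  induction p with
  | nil =>
    simp only [DWalk.support, List.mem_singleton] at hx
    subst hx
    exact ⟨.nil, List.suffix_rfl, List.suffix_rfl⟩
  | cons h p ih =>
    simp only [DWalk.support, List.mem_cons] at hx
    rcases hx with rfl | hx
    · exact ⟨.cons h p, List.suffix_rfl, List.suffix_rfl⟩
    · obtain ⟨q, hq, hq'⟩ := ih hx
      exact ⟨q, hq.trans (List.suffix_cons _ _), hq'.trans (List.suffix_cons _ _)⟩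

/-- The arcs of `Adj` with exactly one end satisfying `f`. -/
def Cross (Adj : V → V → Prop) (f : V → Prop) (u v : V) : Prop :=
  Adj u v ∧ (f u ↔ ¬ f v)

theorem exists_crossing_path {f : V → Prop} {u v : V}
    (h : ReflTransGen (Cross Adj f) u v) :
    ∃ p : DWalk Adj u v, p.IsPath ∧ ∀ e ∈ p.arcs, f e.1 ↔ ¬ f e.2 := by
  induction h using ReflTransGen.head_induction_on with
  | refl => exact ⟨.nil, List.nodup_singleton _, by simp [DWalk.arcs]⟩
  | @head a b hab _ ih =>
    obtain ⟨p, hp, hc⟩ := ih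
    by_cases ha : a ∈ p.support
    · obtain ⟨q, hq, hq'⟩ := p.exists_suffix ha
      exact ⟨q, hp.sublist hq.sublist, fun e he => hc e (hq'.subset he)⟩
    · refine ⟨.cons hab.1 p, List.nodup_cons.2 ⟨ha, hp⟩, ?_⟩
      intro e he
      simp only [DWalk.arcs, List.mem_cons] at he
      rcases he with rfl | he
      · exact hab.2
      · exact hc e he

open Classical in
theorem properlyColoured_of_crossing {f : V → Prop} {u v : V} (p : DWalk Adj u v)
    (h : ∀ e ∈ p.arcs, f e.1 ↔ ¬ f e.2) :
    ProperlyColoured (fun x _ => if f x then 1 else 2) p := by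
  induction p with
  | nil => exact List.isChain_nil
  | cons hab p ih =>
    cases p with
    | nil => exact List.isChain_singleton _
    | cons hbc p =>
      refine List.isChain_cons_cons.2
        ⟨?_, ih fun e he => h e (List.mem_cons_of_mem _ he)⟩
      have := h _ List.mem_cons_self
      dsimp only at this ⊢
      split_ifs <;> simp_all

/-- A partition whose crossing arcs form a strong digraph bounds the proper connection
number by two. -/
theorem pc_le_two_of_crossing (f : V → Prop)
    (h : ∀ u v : V, ReflTransGen (Cross Adj f) u v) : pc Adj ≤ 2 := by
  classical
  refine Nat.sInf_le ⟨fun x _ => if f x then 1 else 2, fun u v _ => ?_, fun u v _ => ?_⟩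
  · dsimp only
    split_ifs <;> simp
  · obtain ⟨p, hp, hc⟩ := exists_crossing_path (h u v)
    refine ⟨p, hp, ?_⟩
    convert properlyColoured_of_crossing p hc

end Crossing

section Even

theorem pc_le_two_of_even {n : ℕ} [NeZero n] (hn : 2 ∣ n) {Adj : ZMod n → ZMod n → Prop}
    (h : ∀ x, Adj x (x + 1)) : pc Adj ≤ 2 := by
  refine pc_le_two_of_crossing (fun x => ZMod.castHom hn (ZMod 2) x = 0) fun u v => ?_
  have key : ∀ j : ℕ, ReflTransGen
      (Cross Adj fun x => ZMod.castHom hn (ZMod 2) x = 0) u (u + j) := by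
    intro j
    induction j with
    | zero => simpa using ReflTransGen.refl
    | succ j ih =>
      rw [Nat.cast_succ, ← add_assoc]
      refine ih.tail ⟨h _, ?_⟩
      dsimp only
      rw [map_add _ _ (1 : ZMod n), map_one]
      generalize ZMod.castHom hn (ZMod 2) (u + j) = a
      revert a
      decide
  simpa using key (v - u).val

end Even

section Segments

/-- The integer `v` lies in the `k`-th of the segments into which the multiples of `n / m`
cut the integers. -/
def InSeg (n m v k : ℤ) : Prop := 0 ≤ k * n - v * m ∧ k * n - v * m < n

/-- The integer `v` is the first one of the `k`-th segment. -/
def IsStart (n m v k : ℤ) : Prop := InSeg n m v k ∧ n ≤ k * n - v * m + m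

/-- The residue classes with a representative `v` in a segment `k` with `v + k` even. -/
def EvenClass (n : ℕ) (m : ℤ) (x : ZMod n) : Prop :=
  ∃ v k : ℤ, (v : ZMod n) = x ∧ InSeg n m v k ∧ Even (v + k)

theorem exists_inSeg {n : ℤ} (hn : 0 < n) (m v : ℤ) : ∃ k, InSeg n m v k := by
  refine ⟨-(-(v * m) / n), ?_⟩
  have h1 := Int.emod_nonneg (-(v * m)) hn.ne'
  have h2 := Int.emod_lt_of_pos (-(v * m)) hn
  have h3 := Int.emod_add_mul_ediv (-(v * m)) n
  constructor <;> nlinarith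

theorem exists_isStart {n m : ℤ} (hm : 0 < m) (hmn : m ≤ n) (k : ℤ) :
    ∃ v, IsStart n m v k := by
  refine ⟨(k - 1) * n / m + 1, ?_⟩
  have h1 := Int.emod_nonneg ((k - 1) * n) hm.ne'
  have h2 := Int.emod_lt_of_pos ((k - 1) * n) hm
  have h3 := Int.emod_add_mul_ediv ((k - 1) * n) m
  refine ⟨⟨?_, ?_⟩, ?_⟩ <;> nlinarith

theorem IsStart.le {n m v w k : ℤ} (hm : 0 < m) (hv : IsStart n m v k) (hw : InSeg n m w k) :
    v ≤ w := by
  by_contra! h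
  have h1 := hv.2
  have h2 := hw.2
  nlinarith

theorem InSeg.eq_of_add_mul {n m v k w l i : ℤ} (hn : 0 < n) (hv : InSeg n m v k)
    (hw : InSeg n m w l) (h : w = v + i * n) : l = k + i * m := by
  subst h
  obtain ⟨h1, h2⟩ := hv
  obtain ⟨h3, h4⟩ := hw
  have h5 : l - k - i * m < 1 := by
    by_contra! h
    nlinarith
  have h6 : -1 < l - k - i * m := by
    by_contra! h
    nlinarith
  omega

theorem InSeg.add_mul {n m v k : ℤ} (h : InSeg n m v k) (i : ℤ) :
    InSeg n m (v + i * n) (k + i * m) := by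
  obtain ⟨h1, h2⟩ := h
  constructor <;> nlinarith

theorem evenClass_iff {n : ℕ} {m v k : ℤ} (hn : 0 < n) (hno : Odd (n : ℤ)) (hmo : Odd m)
    (h : InSeg n m v k) : EvenClass n m v ↔ Even (v + k) := by
  refine ⟨?_, fun he => ⟨v, k, rfl, h, he⟩⟩
  rintro ⟨w, l, hw, hl, he⟩
  obtain ⟨i, hi⟩ := (ZMod.intCast_eq_intCast_iff_dvd_sub _ _ _).1 hw
  have hvi : v = w + i * n := by linarith
  have hk := hl.eq_of_add_mul (by exact_mod_cast hn) h hvi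
  rw [hvi, hk, show w + i * n + (l + i * m) = (w + l) + i * (n + m) by ring]
  exact he.add ((hno.add_odd hmo).mul_left i)

variable {n : ℕ} {m σ κ : ℤ} {Adj : ZMod n → ZMod n → Prop}

theorem crossing_forward (hn : 0 < n) (hno : Odd (n : ℤ)) (hmo : Odd m) (hm : 0 < m)
    (h1 : ∀ x, Adj x (x + 1)) {v w k : ℤ} (hv : InSeg n m v k) (hw : InSeg n m w k)
    (hvw : v ≤ w) : ReflTransGen (Cross Adj (EvenClass n m)) (v : ZMod n) w := by
  induction w, hvw using Int.leInduction with
  | base => exact .refl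
  | succ w hvw ih =>
    have hw' : InSeg n m w k := by
      obtain ⟨a1, a2⟩ := hv
      obtain ⟨a3, a4⟩ := hw
      constructor <;> nlinarith
    refine (ih hw').tail ⟨by simpa using h1 (w : ZMod n), ?_⟩
    rw [evenClass_iff hn hno hmo hw', evenClass_iff hn hno hmo hw]
    simp only [Int.even_iff]
    omega

theorem crossing_chord (hn : 0 < n) (hno : Odd (n : ℤ)) (hmo : Odd m)
    (hσ : ∀ x, Adj x (x + (σ : ZMod n))) (hpar : Odd (σ + κ)) {v k : ℤ}
    (hv : InSeg n m v k) (hw : InSeg n m (v + σ) (k + κ)) :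
    Cross Adj (EvenClass n m) (v : ZMod n) ((v + σ : ℤ) : ZMod n) := by
  refine ⟨by simpa using hσ (v : ZMod n), ?_⟩
  rw [evenClass_iff hn hno hmo hv, evenClass_iff hn hno hmo hw]
  rw [Int.odd_iff] at hpar
  simp only [Int.even_iff]
  omega

theorem crossing_to_start (hn : 0 < n) (hno : Odd (n : ℤ)) (hmo : Odd m) (hm : 0 < m)
    (h1 : ∀ x, Adj x (x + 1)) (hσ : ∀ x, Adj x (x + (σ : ZMod n))) (hpar : Odd (σ + κ))
    (hpos : 0 < κ * n - σ * m) (hle : κ * n - σ * m + m ≤ n) {v w k : ℤ}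
    (hv : InSeg n m v k) (hlate : n ≤ k * n - v * m + (κ * n - σ * m) + m)
    (hw : IsStart n m w (k + κ)) :
    ReflTransGen (Cross Adj (EvenClass n m)) (v : ZMod n) w := by
  obtain ⟨hw1, hw2⟩ := hw
  have hmid : InSeg n m (w - σ) k := by
    obtain ⟨a1, a2⟩ := hw1
    constructor <;> nlinarith
  have hvw : v ≤ w - σ := by
    obtain ⟨a1, a2⟩ := hw1
    by_contra! h
    nlinarith
  have hch := crossing_chord (Adj := Adj) hn hno hmo hσ hpar hmid (by simpa using hw1)
  rw [sub_add_cancel] at hch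
  exact (crossing_forward hn hno hmo hm h1 hv hmid hvw).tail hch

theorem crossing_reaches_start (hn : 0 < n) (hno : Odd (n : ℤ)) (hmo : Odd m) (hm : 0 < m)
    (h1 : ∀ x, Adj x (x + 1)) (hσ : ∀ x, Adj x (x + (σ : ZMod n))) (hpar : Odd (σ + κ))
    (hpos : 0 < κ * n - σ * m) (hle : κ * n - σ * m + m ≤ n) {v k : ℤ}
    (hv : InSeg n m v k) :
    ∃ w l, IsStart n m w l ∧ ReflTransGen (Cross Adj (EvenClass n m)) (v : ZMod n) w := by
  induction hN : (n - (k * n - v * m)).toNat using Nat.strong_induction_on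
    generalizing v k with
  | _ N ih =>
    by_cases hlate : n ≤ k * n - v * m + (κ * n - σ * m) + m
    · obtain ⟨w, hw⟩ := exists_isStart hm (by linarith : m ≤ n) (k + κ)
      exact ⟨w, _, hw, crossing_to_start hn hno hmo hm h1 hσ hpar hpos hle hv hlate hw⟩
    · have hv' : InSeg n m (v + σ) (k + κ) := by
        obtain ⟨a1, a2⟩ := hv
        constructor <;> nlinarith
      have hlt : (n - ((k + κ) * n - (v + σ) * m)).toNat < N := by
        have := hv.2
        rw [← hN, show (k + κ) * n - (v + σ) * m = (k * n - v * m) + (κ * n - σ * m) by ring]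
        omega
      obtain ⟨w, l, hw, hr⟩ := ih _ hlt hv' rfl
      exact ⟨w, l, hw, .head (crossing_chord hn hno hmo hσ hpar hv hv') hr⟩

theorem crossing_start_start (hn : 0 < n) (hno : Odd (n : ℤ)) (hmo : Odd m) (hm : 0 < m)
    (h1 : ∀ x, Adj x (x + 1)) (hσ : ∀ x, Adj x (x + (σ : ZMod n))) (hpar : Odd (σ + κ))
    (hpos : 0 < κ * n - σ * m) (hle : κ * n - σ * m + m ≤ n) {v k : ℤ}
    (hv : IsStart n m v k) (j : ℕ) {w : ℤ} (hw : IsStart n m w (k + j * κ)) :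
    ReflTransGen (Cross Adj (EvenClass n m)) (v : ZMod n) w := by
  induction j generalizing w with
  | zero =>
    simp only [Nat.cast_zero, zero_mul, add_zero] at hw
    rw [le_antisymm (hv.le hm hw.1) (hw.le hm hv.1)]
  | succ j ih =>
    obtain ⟨x, hx⟩ := exists_isStart hm (by linarith : m ≤ n) (k + j * κ)
    refine (ih hx).trans
      (crossing_to_start hn hno hmo hm h1 hσ hpar hpos hle hx.1 (by linarith [hx.2]) ?_)
    rwa [Nat.cast_succ, add_mul, one_mul, ← add_assoc] at hw

/-- A chord of length `σ` advancing by `κ` segments, together with the unit arcs, yields a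
partition with strong crossing digraph. -/
theorem pc_le_two_of_segments (hn : 0 < n) (hno : Odd (n : ℤ)) (hmo : Odd m) (hm : 0 < m)
    (h1 : ∀ x, Adj x (x + 1)) (hσ : ∀ x, Adj x (x + (σ : ZMod n))) (hpar : Odd (σ + κ))
    (hpos : 0 < κ * n - σ * m) (hle : κ * n - σ * m + m ≤ n) (hcop : IsCoprime κ m) :
    pc Adj ≤ 2 := by
  refine pc_le_two_of_crossing (EvenClass n m) fun x y => ?_
  obtain ⟨u, rfl⟩ := ZMod.intCast_surjective x
  obtain ⟨v, rfl⟩ := ZMod.intCast_surjective y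
  have hn' : (0 : ℤ) < n := by exact_mod_cast hn
  obtain ⟨k, hk⟩ := exists_inSeg hn' m u
  obtain ⟨l, hl⟩ := exists_inSeg hn' m v
  obtain ⟨w, k₀, hw, hr⟩ :=
    crossing_reaches_start (Adj := Adj) hn hno hmo hm h1 hσ hpar hpos hle hk
  obtain ⟨a, b, hab⟩ := hcop
  obtain ⟨j, hj⟩ := Int.eq_ofNat_of_zero_le (Int.emod_nonneg ((l - k₀) * a) hm.ne')
  have hdiv := Int.emod_add_mul_ediv ((l - k₀) * a) m
  rw [hj] at hdiv
  obtain ⟨i, hi⟩ : ∃ i, k₀ + j * κ = l + i * m := by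
    refine ⟨-((l - k₀) * b) - ((l - k₀) * a / m) * κ, ?_⟩
    linear_combination κ * hdiv + (l - k₀) * hab
  obtain ⟨z, hz⟩ := exists_isStart hm (by linarith : m ≤ n) (k₀ + j * κ)
  refine hr.trans ((crossing_start_start hn hno hmo hm h1 hσ hpar hpos hle hw j hz).trans ?_)
  rw [hi] at hz
  have hv := hl.add_mul i
  have := crossing_forward (Adj := Adj) hn hno hmo hm h1 hz.1 hv (hz.le hm hv)
  simpa using this

end Segments

theorem exists_odd_segment_count {n T : ℕ} (hn : Odd n) (hT : Even T) (h2 : 2 ≤ T)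
    (hTn : 2 * T + 1 ≤ n) (h7 : ¬ (n = 7 ∧ T = 2)) :
    ∃ m, Odd m ∧ n ≤ m * T ∧ m * (T + 1) ≤ 2 * n := by
  obtain ⟨q, r, hr, hqr⟩ : ∃ q r, r < T ∧ n = T * q + r :=
    ⟨n / T, n % T, Nat.mod_lt _ (by omega), (Nat.div_add_mod n T).symm⟩
  have hr_odd : Odd r := by
    rw [hqr, Nat.odd_add] at hn
    by_contra h
    exact Nat.not_odd_iff_even.2 (hT.mul_right q) (hn.2 (Nat.not_odd_iff_even.1 h))
  have hq : 2 ≤ q := by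
    by_contra! h
    nlinarith
  have hr1 : 1 ≤ r := hr_odd.pos
  rcases Nat.even_or_odd q with he | ho
  · refine ⟨q + 1, he.add_one, by nlinarith, ?_⟩
    zify at *
    nlinarith [mul_nonneg (sub_nonneg.2 hq) (sub_nonneg.2 h2)]
  · refine ⟨q + 2, by simpa [Nat.odd_add] using ho, by nlinarith, ?_⟩
    have hq3 : 3 ≤ q := by
      rcases ho with ⟨c, rfl⟩
      omega
    by_cases hr3 : 3 ≤ r
    · nlinarith
    · have hr' : r = 1 := by
        rcases hr_odd with ⟨c, rfl⟩
        omega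
      subst hr'
      by_cases hT2 : T = 2
      · subst hT2
        have : 5 ≤ q := by
          rcases ho with ⟨c, rfl⟩
          omega
        omega
      · have : 3 ≤ T := by omega
        nlinarith

section Seven

variable {V : Type*} [DecidableEq V]

/-- Depth-first search for a properly coloured path from `u` to `v` that avoids the vertices in
`vis`, does not begin with colour `a`, and has at most `k` arcs, all of which lead from a vertex
to one of its listed successors. -/
def searchPath (succs : V → List V) (c : V → V → ℕ) (v : V) : ℕ → List V → ℕ → V → Bool
  | 0, _, _, u => u == v
  | k + 1, vis, a, u => u == v || (succs u).any fun w =>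
      !(vis.contains w) && c u w != a && searchPath succs c v k (w :: vis) (c u w) w

theorem exists_path_of_searchPath {Adj : V → V → Prop} {succs : V → List V} {c : V → V → ℕ}
    (hs : ∀ u, ∀ w ∈ succs u, Adj u w) {v : V} {k : ℕ} {vis : List V} {a : ℕ} {u : V}
    (h : searchPath succs c v k vis a u = true) (hu : u ∈ vis) :
    ∃ p : DWalk Adj u v, p.IsPath ∧ ((a :: p.arcs.map fun e => c e.1 e.2).IsChain (· ≠ ·)) ∧
      ∀ x ∈ p.support, x = u ∨ x ∉ vis := by
  have hnil : ∀ (vis : List V) (a : ℕ) (u : V), u = v → ∃ p : DWalk Adj u v, p.IsPath ∧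
      ((a :: p.arcs.map fun e => c e.1 e.2).IsChain (· ≠ ·)) ∧
      ∀ x ∈ p.support, x = u ∨ x ∉ vis := by
    rintro vis a u rfl
    exact ⟨.nil, List.nodup_singleton _, List.isChain_singleton _,
      fun x hx => .inl (by simpa [DWalk.support] using hx)⟩
  induction k generalizing vis a u with
  | zero => exact hnil vis a u (by simpa [searchPath] using h)
  | succ k ih =>
    simp only [searchPath, Bool.or_eq_true, beq_iff_eq, List.any_eq_true, Bool.and_eq_true,
      Bool.not_eq_true', List.contains_eq_mem, decide_eq_false_iff_not, bne_iff_ne] at h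
    rcases h with h | ⟨w, hw, ⟨hvis, hca⟩, hrec⟩
    · exact hnil vis a u h
    · obtain ⟨p, hp, hchain, hsup⟩ := ih hrec List.mem_cons_self
      have hsup' : ∀ x ∈ p.support, x ∉ vis := by
        intro x hx
        rcases hsup x hx with rfl | hx'
        · exact hvis
        · exact fun hm => hx' (List.mem_cons_of_mem _ hm)
      refine ⟨.cons (hs u w hw) p, List.nodup_cons.2 ⟨fun hm => hsup' u hm hu, hp⟩,
        List.isChain_cons_cons.2 ⟨hca.symm, hchain⟩, fun x hx => ?_⟩
      rcases List.mem_cons.1 hx with rfl | hx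
      · exact .inl rfl
      · exact .inr (hsup' x hx)

theorem pc_le_two_of_searchPath {Adj : V → V → Prop} {succs : V → List V} {c : V → V → ℕ}
    (hs : ∀ u, ∀ w ∈ succs u, Adj u w) (hc : ∀ u v, c u v ∈ Finset.Icc 1 2) {k : ℕ}
    (h : ∀ u v, searchPath succs c v k [u] 0 u = true) : pc Adj ≤ 2 := by
  refine Nat.sInf_le ⟨c, fun u v _ => hc u v, fun u v _ => ?_⟩
  obtain ⟨p, hp, hchain, -⟩ := exists_path_of_searchPath hs (h u v) List.mem_cons_self
  exact ⟨p, hp, hchain.tail⟩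

theorem pc_le_two_seven_three {Adj : ZMod 7 → ZMod 7 → Prop} (h1 : ∀ x, Adj x (x + 1))
    (h3 : ∀ x, Adj x (x + 3)) : pc Adj ≤ 2 := by
  refine pc_le_two_of_searchPath (succs := fun u => [u + 1, u + 3])
    (c := fun u w => if w = u + 1 then if u ∈ [0, 2, 3, 5] then 2 else 1
      else if u ∈ [1, 2] then 2 else 1) (k := 4) ?_ ?_ ?_
  · simp [h1, h3]
  · decide
  · decide +kernel

theorem pc_le_two_seven_five {Adj : ZMod 7 → ZMod 7 → Prop} (h1 : ∀ x, Adj x (x + 1))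
    (h5 : ∀ x, Adj x (x + 5)) : pc Adj ≤ 2 := by
  refine pc_le_two_of_searchPath (succs := fun u => [u + 1, u + 5])
    (c := fun u w => if w = u + 1 then if u ∈ [0, 2, 3, 4, 5] then 2 else 1
      else if u ∈ [1, 2] then 2 else 1) (k := 4) ?_ ?_ ?_
  · simp [h1, h5]
  · decide
  · decide +kernel

end Seven

theorem pc_le_two_of_odd_odd {n s : ℕ} (hn : Odd n) (hs : Odd s) (hs3 : 3 ≤ s) (hsn : s < n)
    {Adj : ZMod n → ZMod n → Prop} (h1 : ∀ x, Adj x (x + 1))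
    (hadj : ∀ x, Adj x (x + (s : ZMod n))) : pc Adj ≤ 2 := by
  by_cases h73 : n = 7 ∧ s = 3
  · obtain ⟨rfl, rfl⟩ := h73
    exact pc_le_two_seven_three h1 hadj
  by_cases h75 : n = 7 ∧ s = 5
  · obtain ⟨rfl, rfl⟩ := h75
    exact pc_le_two_seven_five h1 hadj
  have hno : Odd (n : ℤ) := by exact_mod_cast hn
  have hso : Odd (s : ℤ) := by exact_mod_cast hs
  obtain ⟨t, rfl⟩ := Nat.exists_eq_add_of_lt hsn
  have ht : Even (t + 1) := by
    rw [add_assoc, Nat.odd_add] at hn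
    exact hn.1 hs
  by_cases hts : t + 1 ≤ s - 1
  · obtain ⟨m, hmo, hm1, hm2⟩ := exists_odd_segment_count hn ht
      (by obtain ⟨c, hc⟩ := ht; omega) (by omega) (by omega)
    have hmo' : Odd (m : ℤ) := by exact_mod_cast hmo
    have hpar : Odd ((-1 : ℤ) * (s + t + 1 : ℕ) - (-(t + 1 : ℕ)) * m) := by
      have ht' : Even ((t + 1 : ℕ) : ℤ) := by exact_mod_cast ht
      rw [neg_one_mul, neg_mul]
      exact hno.neg.sub_even (ht'.mul_right _).neg
    refine pc_le_two_of_segments (m := m) (σ := -(t + 1 : ℕ)) (κ := -1) (by omega) hno hmo'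
      (by exact_mod_cast hmo.pos) h1 (fun x => ?_) ?_ ?_ ?_ isCoprime_one_left.neg_left
    · convert hadj x using 2
      have := ZMod.natCast_self (s + t + 1)
      push_cast at this ⊢
      linear_combination -this
    · have ht' : Even ((t + 1 : ℕ) : ℤ) := by exact_mod_cast ht
      exact ht'.neg.add_odd (by decide)
    · zify at hm1
      refine lt_of_le_of_ne (by push_cast at *; linarith) fun h => ?_
      rw [← h] at hpar
      exact absurd hpar (by decide)
    · zify at hm2
      push_cast
      linarith
  · obtain ⟨m, hmo, hm1, hm2⟩ := exists_odd_segment_count (T := s - 1) hn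
      (Nat.Odd.sub_odd hs odd_one) (by omega) (by omega) (by omega)
    have hmo' : Odd (m : ℤ) := by exact_mod_cast hmo
    have hpar : Odd ((2 : ℤ) * (s + t + 1 : ℕ) - s * m) :=
      (even_two_mul _).sub_odd (hso.mul hmo')
    obtain ⟨T, rfl⟩ : ∃ T, s = T + 1 := ⟨s - 1, by omega⟩
    rw [Nat.add_sub_cancel] at hm1 hm2
    refine pc_le_two_of_segments (m := m) (σ := (T + 1 : ℕ)) (κ := 2) (by omega) hno hmo'
      (by exact_mod_cast hmo.pos) h1 (fun x => by simpa using hadj x)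
      (hso.add_even even_two) ?_ ?_ ?_
    · zify at hm2
      refine lt_of_le_of_ne (by push_cast at *; linarith) fun h => ?_
      rw [← h] at hpar
      exact absurd hpar (by decide)
    · zify at hm1
      push_cast at *
      linarith
    · obtain ⟨c, hc⟩ := hmo'
      exact ⟨-c, 1, by rw [hc]; ring⟩

end PCDigraph

/-- If `n ≥ 4`, `S ⊆ {1, …, n-1}`, `|S| ≥ 2`, and `1 ∈ S`, then the proper
connection number of the circulant digraph `C_n(S)` is at most `2`. -/
theorem pc_circulant_le_two (n : ℕ) (hn : 4 ≤ n) (S : Finset ℕ)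
    (hS : S ⊆ Finset.Icc 1 (n - 1)) (hScard : 2 ≤ S.card) (h1 : 1 ∈ S) :
    pc (circulantAdj n S) ≤ 2 := by
  have : NeZero n := ⟨by omega⟩
  have hadj : ∀ s ∈ S, ∀ x : ZMod n, circulantAdj n S x (x + s) :=
    fun s hs x => ⟨s, hs, by ring⟩
  have hadj1 : ∀ x : ZMod n, circulantAdj n S x (x + 1) := by simpa using hadj 1 h1
  rcases Nat.even_or_odd n with he | ho
  · exact pc_le_two_of_even he.two_dvd hadj1
  obtain ⟨s, hs, hs1⟩ := Finset.exists_mem_ne hScard 1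
  have hsn := Finset.mem_Icc.1 (hS hs)
  rcases Nat.even_or_odd s with hse | hso
  · have hse' : Even (s : ℤ) := by exact_mod_cast hse
    exact pc_le_two_of_segments (m := 1) (σ := s) (κ := 1) (by omega) (by exact_mod_cast ho)
      odd_one one_pos hadj1 (by simpa using hadj s hs) (hse'.add_odd odd_one) (by omega)
      (by omega) isCoprime_one_left
  · refine pc_le_two_of_odd_odd ho hso ?_ (by omega) hadj1 (hadj s hs)
    obtain ⟨c, rfl⟩ := hso
    omega
end

section
/- If n and k are odd integers with n ≥ 5 and 3 ≤ k ≤ n-1, then the proper connection number of the circulant digraph C_n({1,k}) equals 2. -/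
namespace PCDigraph

section Walks

variable {V : Type*} {Adj : V → V → Prop}

/-- Every vertex of a walk is the start of a final segment of that walk. -/
lemma DWalk.exists_dropUntil {u v : V} (p : DWalk Adj u v) {x : V} (hx : x ∈ p.support) :
    ∃ q : DWalk Adj x v, q.support <:+ p.support ∧ q.arcs <:+ p.arcs := by
  induction p with
  | nil =>
    obtain rfl : x = _ := by simpa [DWalk.support] using hx
    exact ⟨.nil, List.suffix_rfl, List.suffix_rfl⟩
  | @cons u w v h p ih =>
    by_cases hxu : x = u
    · subst hxu
      exact ⟨.cons h p, List.suffix_rfl, List.suffix_rfl⟩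
    · obtain ⟨q, hq, hq'⟩ := ih (by simpa [DWalk.support, hxu] using hx)
      exact ⟨q, hq.trans (List.suffix_cons _ _), hq'.trans (List.suffix_cons _ _)⟩

/-- Reachability through a subrelation of `Adj` is witnessed by a path using only arcs of it. -/
lemma exists_isPath_of_reflTransGen {R : V → V → Prop} (hR : ∀ x y, R x y → Adj x y) {u v : V}
    (h : Relation.ReflTransGen R u v) :
    ∃ p : DWalk Adj u v, p.IsPath ∧ ∀ e ∈ p.arcs, R e.1 e.2 := by
  induction h using Relation.ReflTransGen.head_induction_on with
  | refl => exact ⟨.nil, by simp [DWalk.IsPath, DWalk.support], by simp [DWalk.arcs]⟩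
  | @head a b hab _ ih =>
    obtain ⟨p, hp, hpR⟩ := ih
    by_cases ha : a ∈ p.support
    · obtain ⟨q, hq, hq'⟩ := p.exists_dropUntil ha
      exact ⟨q, hp.sublist hq.sublist, fun e he => hpR e (hq'.subset he)⟩
    · refine ⟨.cons (hR _ _ hab) p, List.nodup_cons.2 ⟨ha, hp⟩, fun e he => ?_⟩
      rcases List.mem_cons.1 he with rfl | he
      · exact hab
      · exact hpR e he

/-- A walk along which a vertex labelling `f` changes at every arc is properly coloured when each
arc is coloured according to the label of its tail. -/
lemma properlyColoured_of_alternating {α : Type*} {f : V → α} {g : α → ℕ}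
    (hg : Function.Injective g) {u v : V} (p : DWalk Adj u v)
    (hp : ∀ e ∈ p.arcs, f e.1 ≠ f e.2) : ProperlyColoured (fun x _ => g (f x)) p := by
  induction p with
  | nil => exact List.isChain_nil
  | cons h p ih =>
    have ih := ih fun e he => hp e (List.mem_cons_of_mem _ he)
    have h0 := hp _ List.mem_cons_self
    cases p with
    | nil => exact List.isChain_singleton _
    | cons h' p =>
      simp only [ProperlyColoured, DWalk.arcs, List.map_cons] at ih ⊢
      exact List.IsChain.cons_cons (fun hc => h0 (hg hc)) ih

/-- A labelling with two values whose bichromatic arcs form a strong digraph gives a properly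
connected colouring with two colours. -/
lemma exists_isPCColouring_two_of_alternating (f : V → Bool)
    (h : ∀ u v, Relation.ReflTransGen (fun x y => Adj x y ∧ f x ≠ f y) u v) :
    ∃ c, IsPCColouring Adj 2 c := by
  have hg : Function.Injective (fun b : Bool => if b then 1 else 2 : Bool → ℕ) := by decide
  refine ⟨fun x _ => if f x then 1 else 2, fun u v _ => ?_, fun u v _ => ?_⟩
  · by_cases hu : f u = true <;> simp [hu]
  · obtain ⟨p, hp, hpR⟩ := exists_isPath_of_reflTransGen (fun x y hxy => And.left hxy) (h u v)
    exact ⟨p, hp, properlyColoured_of_alternating hg p fun e he => (hpR e he).2⟩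

/-- A chain of adjacent vertices is the support of a walk. -/
lemma exists_walk_of_isChain (u : V) (l : List V) (h : (u :: l).IsChain Adj) :
    ∃ p : DWalk Adj u ((u :: l).getLast (List.cons_ne_nil u l)),
      p.support = u :: l ∧ p.arcs = (u :: l).zip l := by
  induction l generalizing u with
  | nil => exact ⟨.nil, rfl, rfl⟩
  | cons w l ih =>
    rw [List.isChain_cons_cons] at h
    obtain ⟨p, hp, hp'⟩ := ih w h.2
    exact ⟨.cons h.1 p, by simp [DWalk.support, hp], by simp [DWalk.arcs, hp']⟩

lemma exists_path_of_list {c : V → V → ℕ} {u v : V}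
    (h : ∃ l : List V, (u :: l).getLast (List.cons_ne_nil u l) = v ∧ (u :: l).IsChain Adj ∧
      (u :: l).Nodup ∧ (((u :: l).zip l).map fun e => c e.1 e.2).IsChain (· ≠ ·)) :
    ∃ p : DWalk Adj u v, p.IsPath ∧ ProperlyColoured c p := by
  obtain ⟨l, rfl, hl, hn, hc⟩ := h
  obtain ⟨p, hp, hp'⟩ := exists_walk_of_isChain u l hl
  refine ⟨p, ?_, ?_⟩
  · rw [DWalk.IsPath, hp]; exact hn
  · rw [ProperlyColoured, hp']; exact hc

/-- A colouring with one colour only connects adjacent vertices. -/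
lemma two_le_of_isPCColouring {k : ℕ} {c : V → V → ℕ} (hc : IsPCColouring Adj k c) {u v : V}
    (huv : u ≠ v) (hadj : ¬ Adj u v) : 2 ≤ k := by
  obtain ⟨p, -, hp⟩ := hc.2 u v huv
  match p, hp with
  | .nil, _ => exact absurd rfl huv
  | .cons h .nil, _ => exact absurd h hadj
  | .cons h (.cons h' p), hp =>
    have h1 := hc.1 _ _ h
    have h2 := hc.1 _ _ h'
    have h3 := (List.isChain_cons_cons.1 hp).1
    simp only [Finset.mem_Icc] at h1 h2
    simp only [ne_eq] at h3
    omega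

end Walks

section Circulant

lemma circulantAdj_pair_iff {n k : ℕ} {i j : ZMod n} :
    circulantAdj n {1, k} i j ↔ j = i + 1 ∨ j = i + k := by
  simp only [circulantAdj, Finset.mem_insert, Finset.mem_singleton, exists_eq_or_imp,
    exists_eq_left, Nat.cast_one, sub_eq_iff_eq_add']

/-- The parity of `x + ⌊x M / n⌋`; for `n` and `M` odd it only depends on `x` modulo `n`. -/
def floorParity (n M x : ℕ) : Bool := (x + x * M / n) % 2 = 0

variable {n k M l δ : ℕ}

lemma floorParity_mod (hn : Odd n) (hM : Odd M) (x : ℕ) :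
    floorParity n M (x % n) = floorParity n M x := by
  have hn0 : 0 < n := hn.pos
  have key : ∀ t y, floorParity n M (y + n * t) = floorParity n M y := by
    intro t y
    have h1 : (y + n * t) * M / n = y * M / n + t * M := by
      rw [show (y + n * t) * M = y * M + n * (t * M) by ring, Nat.add_mul_div_left _ _ hn0]
    obtain ⟨r, rfl⟩ := hn
    obtain ⟨s, rfl⟩ := hM
    have h2 : y + (2 * r + 1) * t + (y * (2 * s + 1) / (2 * r + 1) + t * (2 * s + 1)) =
        y + y * (2 * s + 1) / (2 * r + 1) + 2 * (t * (r + s + 1)) := by ring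
    simp only [floorParity, h1, h2, Nat.add_mul_mod_self_left]
  conv_rhs => rw [← Nat.mod_add_div x n]
  rw [key]

lemma floorParity_val_cast (hn : Odd n) (hM : Odd M) (x : ℕ) :
    floorParity n M (x : ZMod n).val = floorParity n M x := by
  rw [ZMod.val_natCast, floorParity_mod hn hM]

lemma floorParity_eq {x q h : ℕ} (hx : x * M = q * n + h) (hh : h < n) :
    floorParity n M x = decide ((x + q) % 2 = 0) := by
  have : x * M / n = q := by
    rw [hx, mul_comm, Nat.mul_add_div (by omega), Nat.div_eq_of_lt hh, add_zero]
  simp [floorParity, this]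

/-- Writing `x M = q n + h`, unit steps raise the height `h` by `M` and steps of length `k` lower
it by `δ`. As `M + δ ≤ n`, any balanced collection of steps can be ordered so that the height
stays in `[0, n)`, and then every step changes `floorParity`. -/
lemma reflTransGen_floorParity (hn : Odd n) (hk : Odd k) (hM : Odd M)
    (hδ : k * M + δ = 2 * l * n) (hle : M + δ ≤ n) (s : ℕ) :
    ∀ a b x q h : ℕ, a + b = s → x * M = q * n + h → h < n → a * δ ≤ h + b * M →
      h + b * M < n + a * δ →
      Relation.ReflTransGen (fun x y : ZMod n => circulantAdj n {1, k} x y ∧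
        floorParity n M x.val ≠ floorParity n M y.val)
        (x : ZMod n) ((x + a * k + b : ℕ) : ZMod n) := by
  induction s with
  | zero =>
    intro a b x q h hab _ _ _ _
    obtain ⟨rfl, rfl⟩ : a = 0 ∧ b = 0 := by omega
    simpa using Relation.ReflTransGen.refl
  | succ s ih =>
    intro a b x q h hab hx hh h1 h2
    by_cases hcase : a ≠ 0 ∧ δ ≤ h
    · obtain ⟨ha, hδh⟩ := hcase
      obtain ⟨a, rfl⟩ := Nat.exists_eq_succ_of_ne_zero ha
      have hx' : (x + k) * M = (q + 2 * l) * n + (h - δ) := by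
        zify [hδh] at hx hδ ⊢
        linear_combination hx + hδ
      simp only [Nat.succ_eq_add_one, add_mul, one_mul] at h1 h2
      have hrec := ih a b (x + k) (q + 2 * l) (h - δ) (by omega) hx' (by omega) (by omega)
        (by omega)
      rw [show x + a.succ * k + b = x + k + a * k + b by rw [Nat.succ_mul]; ring]
      refine Relation.ReflTransGen.head ⟨circulantAdj_pair_iff.2 (Or.inr (by push_cast; rfl)), ?_⟩
        hrec
      rw [floorParity_val_cast hn hM, floorParity_val_cast hn hM, floorParity_eq hx hh,
        floorParity_eq hx' (by omega)]
      obtain ⟨t, rfl⟩ := hk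
      rw [ne_eq, decide_eq_decide]
      omega
    · have hb : b ≠ 0 := by
        rintro rfl
        have ha : a ≠ 0 := by omega
        refine hcase ⟨ha, ?_⟩
        have := Nat.le_mul_of_pos_left δ (Nat.pos_of_ne_zero ha)
        omega
      obtain ⟨b, rfl⟩ := Nat.exists_eq_succ_of_ne_zero hb
      simp only [Nat.succ_eq_add_one, add_mul, one_mul] at h1 h2
      have hhM : h + M < n := by
        by_cases ha : a = 0
        · subst ha
          omega
        · have : ¬ δ ≤ h := fun h' => hcase ⟨ha, h'⟩
          omega
      have hx' : (x + 1) * M = q * n + (h + M) := by linarith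
      have hrec := ih a b (x + 1) q (h + M) (by omega) hx' hhM (by omega) (by omega)
      rw [show x + a * k + b.succ = x + 1 + a * k + b by rw [Nat.succ_eq_add_one]; ring]
      refine Relation.ReflTransGen.head ⟨circulantAdj_pair_iff.2 (Or.inl (by push_cast; rfl)), ?_⟩
        hrec
      rw [floorParity_val_cast hn hM, floorParity_val_cast hn hM, floorParity_eq hx hh,
        floorParity_eq hx' hhM, ne_eq, decide_eq_decide]
      omega

/-- Large simultaneous solutions of `e + c M = 2 l a`. -/
lemma exists_add_mul_eq (hl : 0 < l) (hcop : Nat.Coprime M (2 * l)) (e : ℕ) :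
    ∃ c₀ a₀ : ℕ, ∀ t, e + (c₀ + 2 * l * t) * M = 2 * l * (a₀ + M * t) := by
  obtain ⟨m, -, hm⟩ := Nat.exists_mul_mod_eq_one_of_coprime hcop (by omega)
  obtain ⟨l, rfl⟩ := Nat.exists_eq_succ_of_ne_zero hl.ne'
  have hdm := Nat.div_add_mod (M * m) (2 * l.succ)
  rw [hm] at hdm
  refine ⟨m * (2 * l + 1) * e, e * ((M * m / (2 * l.succ)) * (2 * l + 1) + 1), fun t => ?_⟩
  generalize M * m / (2 * l.succ) = s at hdm ⊢
  simp only [Nat.succ_eq_add_one] at hdm ⊢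
  zify at hdm ⊢
  linear_combination (-(2 * l + 1) * e : ℤ) * hdm

lemma exists_isPCColouring_of_slope (hn : Odd n) (hk : Odd k) (hM : Odd M) (hl : 0 < l)
    (hcop : Nat.Coprime M (2 * l)) (hδ : k * M + δ = 2 * l * n) (hδ0 : 0 < δ)
    (hle : M + δ ≤ n) : ∃ c, IsPCColouring (circulantAdj n {1, k}) 2 c := by
  have hn0 : 0 < n := hn.pos
  have : NeZero n := ⟨hn0.ne'⟩
  refine exists_isPCColouring_two_of_alternating (fun x => floorParity n M x.val) fun u v => ?_
  have hxu : u.val < n := ZMod.val_lt u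
  obtain ⟨d, hd⟩ : ∃ d, u.val + d = v.val + n := ⟨v.val + n - u.val, by omega⟩
  have hx := (Nat.div_add_mod' (u.val * M) n).symm
  have hy := (Nat.div_add_mod' ((v.val + n) * M) n).symm
  have hh := Nat.mod_lt (u.val * M) hn0
  have hh' := Nat.mod_lt ((v.val + n) * M) hn0
  obtain ⟨e, he⟩ : ∃ e, (v.val + n) * M / n = u.val * M / n + e :=
    Nat.exists_eq_add_of_le (Nat.div_le_div_right (Nat.mul_le_mul_right M (by omega)))
  rw [he] at hy
  generalize u.val * M / n = q at hx hy he
  generalize u.val * M % n = h at hx hh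
  generalize (v.val + n) * M % n = h' at hy hh'
  obtain ⟨c₀, a₀, hca⟩ := exists_add_mul_eq hl hcop e
  obtain ⟨t, ht⟩ : ∃ t, t = a₀ * k := ⟨_, rfl⟩
  specialize hca t
  obtain ⟨c, hc⟩ : ∃ c, c = c₀ + 2 * l * t := ⟨_, rfl⟩
  obtain ⟨a, ha⟩ : ∃ a, a = a₀ + M * t := ⟨_, rfl⟩
  rw [← hc, ← ha] at hca
  obtain ⟨b, hb⟩ : ∃ b, u.val + a * k + b = v.val + n + c * n := by
    have h1 : t ≤ t * δ := Nat.le_mul_of_pos_right t hδ0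
    have h2 : a * k + t * δ = t + 2 * l * t * n := by
      rw [ha]
      zify at hδ ht ⊢
      linear_combination t * hδ - ht
    have h3 : a * k ≤ c * n := by
      have h4 : c * n = c₀ * n + 2 * l * t * n := by rw [hc, add_mul]
      omega
    exact ⟨d + (c * n - a * k), by omega⟩
  have hheight : h + b * M = h' + a * δ := by
    zify at hb hx hy hδ hca ⊢
    linear_combination M * hb - hx + hy - a * hδ + n * hca
  have := reflTransGen_floorParity hn hk hM hδ hle (a + b) a b u.val q h rfl hx hh (by omega)
    (by omega)
  rw [hb] at this
  simpa using this

lemma exists_odd_slope (hn : Odd n) (hk : Odd k) (hk3 : 3 ≤ k) (hkn : 2 * k ≤ n + 1)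
    (h7 : ¬ (n = 7 ∧ k = 3)) : ∃ M, Odd M ∧ 3 ≤ M ∧ k * M < 2 * n ∧ n < M * (k - 1) := by
  obtain ⟨r, rfl⟩ := hn
  obtain ⟨p, rfl⟩ := hk
  have hp : 1 ≤ p := by omega
  obtain ⟨m, hm⟩ : ∃ m, m = (r + p) / (2 * p) := ⟨_, rfl⟩
  have h1 : 2 * p * m ≤ r + p := hm ▸ Nat.mul_div_le _ _
  have h2 : r + p < 2 * p * (m + 1) := hm ▸ Nat.lt_mul_div_succ _ (by omega)
  have hm1 : 1 ≤ m := by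
    by_contra! h
    obtain rfl : m = 0 := by omega
    omega
  refine ⟨2 * m + 1, ⟨m, rfl⟩, by omega, ?_, ?_⟩
  · rcases (by omega : m = 1 ∨ m = 2 ∨ 3 ≤ m) with rfl | rfl | hm3
    · omega
    · omega
    · nlinarith [mul_le_mul hp hm3 (by omega) (by omega)]
  · simp only [Nat.add_sub_cancel]
    nlinarith

set_option maxRecDepth 100000 in
/-- An explicit colouring of `C_7({1,3})`, which has no strong 2-partition. -/
lemma exists_isPCColouring_seven_three : ∃ c, IsPCColouring (circulantAdj 7 {1, 3}) 2 c := by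
  let c : ZMod 7 → ZMod 7 → ℕ := fun u v =>
    if v = u + 1 then [1, 2, 1, 2, 1, 1, 1].getD u.val 1 else [2, 2, 2, 2, 2, 1, 1].getD u.val 1
  let T : List (List (List (ZMod 7))) := [
    [[1, 2, 3, 4, 5], [1, 2, 3, 6]],
    [[2, 3, 4, 5], [2, 3, 6, 0]],
    [[3, 4, 5], [3, 6, 0], [5, 1, 4]],
    [[6, 2, 5, 1, 4], [6, 0]],
    [[0, 1, 2, 3, 6], [5]],
    [[1, 2, 3, 6, 0], [1, 2, 3, 4]],
    [[2, 5, 1, 4], [0, 3]]]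
  have hadj : circulantAdj 7 {1, 3} = fun i j : ZMod 7 => j = i + 1 ∨ j = i + 3 := by
    funext i j
    exact propext circulantAdj_pair_iff
  rw [hadj]
  refine ⟨c, by decide, fun u v huv => exists_path_of_list ?_⟩
  have key : ∀ u v : ZMod 7, u ≠ v → ∃ l ∈ (T.getD u.val []).flatMap List.inits,
      (u :: l).getLast (List.cons_ne_nil u l) = v ∧
      (u :: l).IsChain (fun i j : ZMod 7 => j = i + 1 ∨ j = i + 3) ∧
      (u :: l).Nodup ∧ (((u :: l).zip l).map fun e => c e.1 e.2).IsChain (· ≠ ·) := by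
    decide
  obtain ⟨l, -, hl⟩ := key u v huv
  exact ⟨l, hl⟩

set_option maxRecDepth 100000 in
/-- An explicit colouring of `C_7({1,5})`, which has no strong 2-partition. -/
lemma exists_isPCColouring_seven_five : ∃ c, IsPCColouring (circulantAdj 7 {1, 5}) 2 c := by
  let c : ZMod 7 → ZMod 7 → ℕ := fun u v =>
    if v = u + 1 then [2, 2, 2, 2, 1, 2, 1].getD u.val 1 else [2, 1, 1, 1, 1, 1, 1].getD u.val 1
  let T : List (List (List (ZMod 7))) := [
    [[5, 3, 4, 2], [1, 6]],
    [[2, 0, 5, 3, 4], [6]],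
    [[0, 5, 3, 4], [0, 1, 6]],
    [[4, 5, 6, 0, 1], [4, 2]],
    [[5, 6, 0, 1], [2, 3, 1]],
    [[6, 0, 1], [3, 4, 2]],
    [[0, 5, 3, 4, 2], [0, 1]]]
  have hadj : circulantAdj 7 {1, 5} = fun i j : ZMod 7 => j = i + 1 ∨ j = i + 5 := by
    funext i j
    exact propext circulantAdj_pair_iff
  rw [hadj]
  refine ⟨c, by decide, fun u v huv => exists_path_of_list ?_⟩
  have key : ∀ u v : ZMod 7, u ≠ v → ∃ l ∈ (T.getD u.val []).flatMap List.inits,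
      (u :: l).getLast (List.cons_ne_nil u l) = v ∧
      (u :: l).IsChain (fun i j : ZMod 7 => j = i + 1 ∨ j = i + 5) ∧
      (u :: l).Nodup ∧ (((u :: l).zip l).map fun e => c e.1 e.2).IsChain (· ≠ ·) := by
    decide
  obtain ⟨l, -, hl⟩ := key u v huv
  exact ⟨l, hl⟩

lemma exists_isPCColouring_two (hn : Odd n) (hk : Odd k) (hk3 : 3 ≤ k) (hkn : k ≤ n - 1) :
    ∃ c, IsPCColouring (circulantAdj n {1, k}) 2 c := by
  by_cases h73 : n = 7 ∧ k = 3
  · obtain ⟨rfl, rfl⟩ := h73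
    exact exists_isPCColouring_seven_three
  by_cases h75 : n = 7 ∧ k = 5
  · obtain ⟨rfl, rfl⟩ := h75
    exact exists_isPCColouring_seven_five
  by_cases hsmall : 2 * k ≤ n + 1
  · obtain ⟨M, hM, -, h1, h2⟩ := exists_odd_slope hn hk hk3 hsmall h73
    obtain ⟨k, rfl⟩ : ∃ j, k = j + 1 := ⟨k - 1, by omega⟩
    refine exists_isPCColouring_of_slope (l := 1) (δ := 2 * n - (k + 1) * M) hn hk hM one_pos
      (Nat.coprime_two_right.2 hM) (by omega) (by omega) ?_
    have : (k + 1) * M = M * (k + 1 - 1) + M := by simp; ring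
    omega
  · obtain ⟨j, hj⟩ : ∃ j, n + 1 = k + j := ⟨n + 1 - k, by omega⟩
    have hjodd : Odd j := by
      obtain ⟨r, rfl⟩ := hn
      obtain ⟨p, rfl⟩ := hk
      exact ⟨r - p, by omega⟩
    have hj3 : 3 ≤ j := by
      obtain ⟨i, rfl⟩ := hjodd
      omega
    obtain ⟨M, hM, hM3, h1, h2⟩ := exists_odd_slope hn hjodd hj3 (by omega) (by omega)
    obtain ⟨m, rfl⟩ := hM
    obtain ⟨j, rfl⟩ : ∃ i, j = i + 1 := ⟨j - 1, by omega⟩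
    obtain rfl : n = k + j := by omega
    simp only [Nat.add_sub_cancel] at h2
    refine exists_isPCColouring_of_slope (l := m) (δ := (2 * m + 1) * j - (k + j)) hn hk ⟨m, rfl⟩
      (by omega) (by simp) ?_ (by omega) ?_
    · zify [h2.le]
      ring
    · have : (j + 1) * (2 * m + 1) = (2 * m + 1) * j + (2 * m + 1) := by ring
      omega

end Circulant

end PCDigraph

open PCDigraph

/-- If `n` and `k` are odd integers with `n ≥ 5` and `3 ≤ k ≤ n - 1`, then the
proper connection number of the circulant digraph `C_n({1, k})` equals `2`. -/
theorem pc_circulant_one_k_eq_two (n k : ℕ) (hnodd : Odd n) (hkodd : Odd k)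
    (hn : 5 ≤ n) (hk3 : 3 ≤ k) (hkn : k ≤ n - 1) :
    pc (circulantAdj n {1, k}) = 2 := by
  have hcast : ∀ {a : ℕ}, a < n → a ≠ 2 → ((2 : ℕ) : ZMod n) ≠ (a : ℕ) := by
    intro a ha ha2 h
    have := (ZMod.natCast_eq_natCast_iff' _ _ _).1 h
    rw [Nat.mod_eq_of_lt (by omega), Nat.mod_eq_of_lt ha] at this
    exact ha2 this.symm
  refine IsLeast.csInf_eq ⟨exists_isPCColouring_two hnodd hkodd hk3 hkn, ?_⟩
  rintro i ⟨c, hc⟩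
  refine two_le_of_isPCColouring hc (u := 0) (v := ((2 : ℕ) : ZMod n)) ?_ ?_
  · simpa using (hcast (a := 0) (by omega) (by omega)).symm
  · rw [circulantAdj_pair_iff, zero_add, zero_add, not_or]
    refine ⟨by simpa using hcast (a := 1) (by omega) (by omega), hcast (by omega) ?_⟩
    rintro rfl
    exact absurd hkodd (by decide)
end

section
/- If n and k are odd integers with n ≥ 9 and 3 ≤ k ≤ n-1, then the circulant digraph C_n({1,k}) contains a spanning subdigraph that is strong and bipartite. -/
open PCDigraph

namespace PCDigraph

variable {V : Type*} {Adj : V → V → Prop}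

/-- A directed path through `a` contains a directed path from `a` to its endpoint. -/
theorem DWalk.IsPath.exists_from_mem_support {u v a : V} {p : DWalk Adj u v} (hp : p.IsPath)
    (ha : a ∈ p.support) : ∃ q : DWalk Adj a v, q.IsPath := by
  induction p with
  | nil =>
    obtain rfl : a = _ := by simpa [DWalk.support] using ha
    exact ⟨.nil, by simp [DWalk.IsPath, DWalk.support]⟩
  | cons h p ih =>
    have hp' : p.IsPath := by
      simp only [DWalk.IsPath, DWalk.support, List.nodup_cons] at hp ⊢
      exact hp.2
    simp only [DWalk.support, List.mem_cons] at ha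
    rcases ha with rfl | ha
    · exact ⟨.cons h p, hp⟩
    · exact ih hp' ha

theorem exists_isPath_of_reflTransGen_s11 {u v : V} (h : Relation.ReflTransGen Adj u v) :
    ∃ p : DWalk Adj u v, p.IsPath := by
  induction h using Relation.ReflTransGen.head_induction_on with
  | refl => exact ⟨.nil, by simp [DWalk.IsPath, DWalk.support]⟩
  | @head a c hac _ ih =>
    obtain ⟨p, hp⟩ := ih
    by_cases ha : a ∈ p.support
    · exact hp.exists_from_mem_support ha
    · refine ⟨.cons hac p, ?_⟩
      simp only [DWalk.IsPath, DWalk.support, List.nodup_cons]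
      exact ⟨ha, hp⟩

end PCDigraph

/-- Cut `ℤ` into the blocks `[s j, s (j + 1))`, periodically. Suppose that one may move one step
forward inside a block, and from block `j` by `δ` whenever this leads into block `j + e`. If a
jump never increases the offset in the block, and the start of block `j + e` can be hit from
block `j`, then every integer can be reached from every other one modulo the period. -/
theorem reach_of_block_jumps {n r δ e : ℤ} (hr : 0 < r) (hdrop : r * δ < e * n)
    {s b : ℤ → ℤ} (hb : ∀ j x, s j ≤ x ↔ j ≤ b x)
    (hs : ∀ j q, s (j + r * q) = s j + n * q)
    (hjump_le : ∀ j, s j + δ ≤ s (j + e)) (hlt_jump : ∀ j, s (j + e) < s (j + 1) + δ)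
    (he : ∀ i j : ℤ, ∃ (t : ℕ) (q : ℤ), i + e * t = j + r * q)
    {reach : ℤ → ℤ → Prop} (htrans : ∀ x y z, reach x y → reach y z → reach x z)
    (hper : ∀ x q, reach (x + n * q) x)
    (hstep : ∀ j x, s j ≤ x → x + 1 < s (j + 1) → reach x (x + 1))
    (hjump : ∀ j x, s j ≤ x → x < s (j + 1) → s (j + e) ≤ x + δ → reach x (x + δ))
    (x y : ℤ) : reach x y := by
  have hrefl : ∀ x, reach x x := fun x => by simpa using hper x 0
  have hwalk : ∀ j x y, s j ≤ x → x ≤ y → y < s (j + 1) → reach x y := by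
    intro j x y hx hxy
    induction y, hxy using Int.leInduction with
    | base => exact fun _ => hrefl x
    | succ y hxy ih =>
      exact fun hy => htrans _ _ _ (ih (by lia)) (hstep j y (by lia) hy)
  have hnext : ∀ j x, s j ≤ x → x ≤ s (j + e) - δ → reach x (s (j + e)) := by
    intro j x hx hxe
    have h1 := hlt_jump j
    have h2 := hjump j (s (j + e) - δ) (by lia) (by lia) (by lia)
    rw [sub_add_cancel] at h2
    exact htrans _ _ _ (hwalk j x _ hx hxe (by lia)) h2
  have hstart : ∀ i (t : ℕ), reach (s i) (s (i + e * t)) := by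
    intro i t
    induction t with
    | zero => simpa using hrefl (s i)
    | succ t ih =>
      refine htrans _ _ _ ih ?_
      have h1 := hnext (i + e * t) (s (i + e * t)) le_rfl (by linarith [hjump_le (i + e * t)])
      rwa [show i + e * t + e = i + e * ((t + 1 : ℕ) : ℤ) by push_cast; ring] at h1
  have hstarts : ∀ i j, reach (s i) (s j) := by
    intro i j
    obtain ⟨t, q, htq⟩ := he i j
    have h1 := hstart i t
    rw [htq, hs] at h1
    exact htrans _ _ _ h1 (hper _ _)
  have hblock : ∀ x, s (b x) ≤ x ∧ x < s (b x + 1) := fun x =>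
    ⟨(hb _ _).2 le_rfl, not_le.1 fun h => by have := (hb _ _).1 h; lia⟩
  have hreach_start : ∃ i, reach x (s i) := by
    by_contra! hno
    obtain ⟨hx1, hx2⟩ := hblock x
    have key : ∀ N : ℕ, s (b x + e * N) ≤ x + δ * N ∧ x + δ * N < s (b x + e * N + 1) ∧
        reach x (x + δ * N) := by
      intro N
      induction N with
      | zero => simpa using ⟨hx1, hx2, hrefl x⟩
      | succ N ih =>
        obtain ⟨h1, h2, h3⟩ := ih
        rw [show b x + e * ((N + 1 : ℕ) : ℤ) = b x + e * N + e by push_cast; ring,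
          show x + δ * ((N + 1 : ℕ) : ℤ) = x + δ * N + δ by push_cast; ring]
        have h4 : s (b x + e * N + e) ≤ x + δ * N + δ := by
          by_contra! h
          exact hno _ (htrans _ _ _ h3 (hnext _ _ h1 (by lia)))
        refine ⟨h4, ?_, htrans _ _ _ h3 (hjump _ _ h1 h2 h4)⟩
        have h5 := hjump_le (b x + e * N + 1)
        rw [show b x + e * N + 1 + e = b x + e * N + e + 1 by ring] at h5
        lia
    obtain ⟨d, hd⟩ := Int.eq_ofNat_of_zero_le (show 0 ≤ x - s (b x) by lia)
    obtain ⟨r', rfl⟩ := Int.eq_ofNat_of_zero_le hr.le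
    have h1 := (key (r' * (d + 1))).1
    rw [show e * ((r' * (d + 1) : ℕ) : ℤ) = r' * (e * (d + 1)) by push_cast; ring, hs] at h1
    push_cast at h1
    nlinarith
  obtain ⟨i, hi⟩ := hreach_start
  obtain ⟨hy1, hy2⟩ := hblock y
  exact htrans _ _ _ hi (htrans _ _ _ (hstarts i (b y)) (hwalk _ _ _ le_rfl hy1 hy2))

/-- A periodic block structure on `ℤ` as in `reach_of_block_jumps` yields a strong bipartite
spanning subdigraph of the circulant digraph, two-coloured by the parity of position plus block
index. -/
theorem exists_strong_bipartite_of_blocks {n k : ℕ} {r δ e : ℤ} (hn : Odd n) (hr : Odd r)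
    (hr0 : 0 < r) (hδe : Odd (δ + e)) (hδ : ∃ q : ℤ, (k : ℤ) = δ + n * q)
    (hdrop : r * δ < e * n) {s b : ℤ → ℤ} (hb : ∀ j x, s j ≤ x ↔ j ≤ b x)
    (hs : ∀ j q, s (j + r * q) = s j + n * q)
    (hjump_le : ∀ j, s j + δ ≤ s (j + e)) (hlt_jump : ∀ j, s (j + e) < s (j + 1) + δ)
    (he : ∀ i j : ℤ, ∃ (t : ℕ) (q : ℤ), i + e * t = j + r * q) :
    ∃ Adj' : ZMod n → ZMod n → Prop,
      (∀ u v : ZMod n, Adj' u v → circulantAdj n {1, k} u v) ∧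
        Strong Adj' ∧ Bipartite Adj' := by
  have hb_eq : ∀ j x, s j ≤ x → x < s (j + 1) → b x = j := by
    intro j x h1 h2
    have h3 := (hb _ _).1 h1
    have h4 := mt (hb (j + 1) x).2 (not_le.2 h2)
    lia
  have hb_add : ∀ x q, b (x + n * q) = b x + r * q := by
    intro x q
    refine hb_eq _ _ ?_ ?_
    · rw [hs]
      have := (hb (b x) x).2 le_rfl
      lia
    · rw [show b x + r * q + 1 = b x + 1 + r * q by ring, hs]
      have := mt (hb (b x + 1) x).1 (by lia)
      lia
  have hcol : ∀ x y : ℤ, (x : ZMod n) = y → (Even (x + b x) ↔ Even (y + b y)) := by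
    intro x y hxy
    obtain ⟨q, hq⟩ := (ZMod.intCast_eq_intCast_iff_dvd_sub x y n).1 hxy
    obtain rfl : y = x + n * q := by lia
    have hn' : Odd (n : ℤ) := by exact_mod_cast hn
    have : Even ((n + r) * q) := (hn'.add_odd hr).mul_right q
    rw [hb_add, show x + n * q + (b x + r * q) = x + b x + (n + r) * q by ring]
    exact ⟨fun h => h.add this, fun h => by simpa using h.sub this⟩
  set A : Set (ZMod n) := {u | ∃ x : ℤ, (x : ZMod n) = u ∧ Even (x + b x)}
  have hmem : ∀ x : ℤ, (x : ZMod n) ∈ A ↔ Even (x + b x) := fun x =>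
    ⟨fun ⟨y, hy, h⟩ => (hcol y x hy).1 h, fun h => ⟨x, rfl, h⟩⟩
  refine ⟨fun u v => circulantAdj n {1, k} u v ∧ (u ∈ A ↔ v ∉ A), fun u v h => h.1, ?_,
    A, Aᶜ, Set.union_compl_self A, disjoint_compl_right, ?_⟩
  · intro u v
    refine exists_isPath_of_reflTransGen_s11 ?_
    obtain ⟨x, rfl⟩ := ZMod.intCast_surjective u
    obtain ⟨y, rfl⟩ := ZMod.intCast_surjective v
    refine reach_of_block_jumps (n := n) hr0 hdrop hb hs hjump_le hlt_jump he
      (reach := fun x y : ℤ => Relation.ReflTransGen _ (x : ZMod n) (y : ZMod n))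
      (fun _ _ _ => Relation.ReflTransGen.trans) ?_ ?_ ?_ x y
    · intro x q
      simp [Relation.ReflTransGen.refl]
    · intro j x h1 h2
      refine .single ⟨⟨1, by simp, by simp⟩, ?_⟩
      rw [hmem, hmem, hb_eq j x h1 (by lia), hb_eq j (x + 1) (by lia) h2]
      grind
    · intro j x h1 h2 h3
      obtain ⟨q, hq⟩ := hδ
      have hkδ : (k : ZMod n) = (δ : ZMod n) := by
        have := congrArg (Int.cast : ℤ → ZMod n) hq
        simpa using this
      refine .single ⟨⟨k, by simp, by simp [hkδ]⟩, ?_⟩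
      have h4 := hjump_le (j + 1)
      rw [show j + 1 + e = j + e + 1 by ring] at h4
      rw [hmem, hmem, hb_eq j x h1 h2, hb_eq (j + e) (x + δ) h3 (by lia)]
      grind
  · rintro u v ⟨-, h⟩
    by_cases hu : u ∈ A
    · exact .inl ⟨hu, h.1 hu⟩
    · exact .inr ⟨hu, by_contra fun hv => hu (h.2 hv)⟩

/-- There is an odd number `r` of blocks for which `n / r` lies between `(M + 1) / 2` and `M`. -/
theorem exists_odd_block_count {n M : ℕ} (hn : Odd n) (hM : Even M) (hM0 : 0 < M)
    (hMn : 2 * M + 1 ≤ n) (hn9 : 9 ≤ n) : ∃ r : ℕ, Odd r ∧ n ≤ r * M ∧ r * (M + 1) ≤ 2 * n := by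
  obtain ⟨q, t, hqt, htM⟩ : ∃ q t, n = q * M + t ∧ t < M :=
    ⟨n / M, n % M, (Nat.div_add_mod' n M).symm, Nat.mod_lt _ hM0⟩
  have ht : 1 ≤ t := by
    have : Odd t := by
      have h := hM.mul_left q
      grind
    exact this.pos
  have hM2 : 2 ≤ M := by grind
  have hq2 : 2 ≤ q := by
    by_contra! h
    have : q * M ≤ 1 * M := Nat.mul_le_mul_right _ (by lia)
    lia
  rcases Nat.even_or_odd q with hq | hq
  · refine ⟨q + 1, hq.add_one, by lia, ?_⟩
    obtain ⟨q, rfl⟩ := Nat.exists_eq_add_of_le hq2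
    nlinarith [Nat.zero_le (q * (M - 2)), Nat.mul_le_mul_left q hM2]
  · refine ⟨q + 2, by grind, by lia, ?_⟩
    have hq3 : 3 ≤ q := by grind
    rcases hq3.eq_or_lt with rfl | hq4
    · grind
    · obtain ⟨q, rfl⟩ := Nat.exists_eq_add_of_le hq4
      nlinarith [Nat.mul_le_mul_left q hM2]

/-- The balanced cut points `⌊j n / r⌋`. -/
theorem exists_balanced_blocks {n r M : ℤ} (hr : 0 < r) (hn : 0 < n) (h1 : n ≤ r * M)
    (h2 : r * (M + 1) ≤ 2 * n) : ∃ s b : ℤ → ℤ, (∀ j x, s j ≤ x ↔ j ≤ b x) ∧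
      (∀ j q, s (j + r * q) = s j + n * q) ∧
      (∀ j, s (j + 1) ≤ s j + M) ∧ ∀ j, s j + M + 1 ≤ s (j + 2) := by
  refine ⟨fun j => j * n / r, fun x => (r * (x + 1) - 1) / n, ?_, ?_, ?_, ?_⟩
  · intro j x
    rw [Int.le_ediv_iff_mul_le (by lia), ← Int.lt_add_one_iff, Int.ediv_lt_iff_lt_mul hr,
      mul_comm r]
    lia
  · intro j q
    simp only
    rw [show (j + r * q) * n = j * n + r * (n * q) by ring, Int.add_mul_ediv_left _ _ hr.ne']
  · intro j
    simp only
    rw [← Int.lt_add_one_iff, Int.ediv_lt_iff_lt_mul hr]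
    nlinarith [Int.lt_ediv_add_one_mul_self (j * n) hr]
  · intro j
    simp only
    rw [Int.le_ediv_iff_mul_le hr]
    nlinarith [Int.ediv_mul_le (j * n) hr.ne']

/-- If `n` and `k` are odd integers with `n ≥ 9` and `3 ≤ k ≤ n - 1`, then the
circulant digraph `C_n({1, k})` contains a spanning subdigraph that is strong
and bipartite. -/
theorem circulant_one_k_strong_bipartite_spanning (n k : ℕ)
    (hnodd : Odd n) (hkodd : Odd k) (hn : 9 ≤ n) (hk3 : 3 ≤ k) (hkn : k ≤ n - 1) :
    ∃ Adj' : ZMod n → ZMod n → Prop,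
      (∀ u v : ZMod n, Adj' u v → circulantAdj n {1, k} u v) ∧
        Strong Adj' ∧ Bipartite Adj' := by
  obtain ⟨a, rfl⟩ := hkodd
  obtain ⟨c, hc⟩ := id hnodd
  rcases le_total (2 * (2 * a + 1)) (n + 1) with hle | hle
  · obtain ⟨r, hr, h1, h2⟩ := exists_odd_block_count (M := 2 * a) hnodd (by simp) (by lia)
      (by lia) hn
    have hr' : Odd (r : ℤ) := by exact_mod_cast hr
    have hr0 : 0 < (r : ℤ) := by exact_mod_cast hr.pos
    obtain ⟨s, b, hb, hs, hL, hU⟩ := exists_balanced_blocks (n := n) (M := 2 * a) hr0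
      (by lia) (by exact_mod_cast h1) (by exact_mod_cast h2)
    refine exists_strong_bipartite_of_blocks (δ := 2 * a + 1) (e := 2) hnodd hr' hr0
      ⟨a + 1, by ring⟩ ⟨0, by push_cast; ring⟩ ?_ hb hs (fun j => by linarith [hU j]) ?_ ?_
    · have h3 : Odd ((r : ℤ) * (2 * a + 1)) := hr'.mul ⟨a, rfl⟩
      refine lt_of_le_of_ne (by exact_mod_cast h2) fun h => ?_
      rw [h] at h3
      grind
    · intro j
      have := hL (j + 1)
      rw [show j + 1 + 1 = j + 2 by ring] at this
      lia
    · intro i j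
      obtain ⟨d, hd⟩ := hr'
      obtain ⟨t, ht⟩ := Int.eq_ofNat_of_zero_le
        (Int.emod_nonneg ((j - i) * (d + 1)) hr0.ne')
      have h3 := Int.emod_add_mul_ediv ((j - i) * (d + 1)) r
      refine ⟨t, (j - i) - 2 * ((j - i) * (d + 1) / r), ?_⟩
      linear_combination (-2) * ht + 2 * h3 + (i - j) * hd
  · obtain ⟨m, hm⟩ : ∃ m, n = 2 * a + 1 + m := ⟨n - (2 * a + 1), by lia⟩
    have hme : Even m := Nat.even_iff.2 (by lia)
    obtain ⟨r, hr, h1, h2⟩ := exists_odd_block_count (M := m) hnodd hme (by lia)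
      (by lia) hn
    have hr' : Odd (r : ℤ) := by exact_mod_cast hr
    have hr0 : 0 < (r : ℤ) := by exact_mod_cast hr.pos
    obtain ⟨s, b, hb, hs, hL, hU⟩ := exists_balanced_blocks (n := n) (M := m) hr0
      (by lia) (by exact_mod_cast h1) (by exact_mod_cast h2)
    have hm' : Even (m : ℤ) := by exact_mod_cast hme
    refine exists_strong_bipartite_of_blocks (δ := -m) (e := -1) hnodd hr' hr0
      (by grind) ⟨1, by lia⟩ ?_ hb hs ?_ ?_ ?_
    · have h3 : Even (r * m) := hme.mul_left _
      have h4 : n < r * m := lt_of_le_of_ne h1 fun h => by grind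
      zify at h4
      linarith
    · intro j
      have := hL (j + -1)
      rw [neg_add_cancel_right] at this
      lia
    · intro j
      have := hU (j + -1)
      rw [show j + -1 + 2 = j + 1 by ring] at this
      lia
    · intro i j
      obtain ⟨t, ht⟩ := Int.eq_ofNat_of_zero_le (Int.emod_nonneg (i - j) hr0.ne')
      exact ⟨t, (i - j) / r, by linarith [Int.emod_add_mul_ediv (i - j) r]⟩
end
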